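/- Suppose there exist real constants λ, μ such that on (a,b): sin φ + 1/sin φ + (φ'' cos φ)/(2φ'²) − (H cos²φ)/(φ' sin φ) = λ p and −(3/2)cos φ + (φ'' sin φ)/(2φ'²) − (sin φ cos φ)/(2 p φ') = μ q. Then either H ≡ 0 on (a,b) or p² + q² is constant on (a,b). -/

import Mathlib

open Real Set

/-- The derivative of a function vanishing on an open set vanishes there. -/
theorem HasDerivAt.eq_zero_of_eqOn_isOpen {f : ℝ → ℝ} {f' x : ℝ} {U : Set ℝ}
    (hf : HasDerivAt f f' x) (hU : IsOpen U) (hx : x ∈ U) (h : ∀ u ∈ U, f u = 0) : f' = 0 := by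
  have h0 : HasDerivAt f 0 x :=
    (hasDerivAt_const x (0 : ℝ)).congr_of_eventuallyEq
      (Filter.eventually_of_mem (hU.mem_nhds hx) h)
  exact hf.unique h0

/-- A continuous function either vanishes on an open set or is nonzero on a nonempty open subset. -/
theorem eqOn_zero_or_exists_isOpen_ne_zero {f : ℝ → ℝ} (hf : Continuous f) {U : Set ℝ}
    (hU : IsOpen U) :
    (∀ u ∈ U, f u = 0) ∨ ∃ V ⊆ U, IsOpen V ∧ V.Nonempty ∧ ∀ u ∈ V, f u ≠ 0 := by
  by_cases h : ∀ u ∈ U, f u = 0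
  · exact Or.inl h
  · push Not at h
    obtain ⟨x, hx, hfx⟩ := h
    exact Or.inr ⟨U ∩ {u | f u ≠ 0}, inter_subset_left,
      hU.inter (isOpen_ne_fun hf continuous_const), ⟨x, hx, hfx⟩, fun u hu => hu.2⟩

/-- If `φ` has nonvanishing derivative and `sin φ ≠ 0` on a nonempty open set, then `cos φ` does
not satisfy `D cos² φ = C` there with `D ≠ 0`. -/
theorem not_cos_sq_const {φ k : ℝ → ℝ} {U : Set ℝ} (hU : IsOpen U) (hne : U.Nonempty)
    (hφ : ∀ u ∈ U, HasDerivAt φ (k u) u) (hk : ∀ u ∈ U, k u ≠ 0)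
    (hs : ∀ u ∈ U, sin (φ u) ≠ 0) {D C : ℝ} (hD : D ≠ 0)
    (h : ∀ u ∈ U, D * cos (φ u) ^ 2 - C = 0) : False := by
  have hc : ∀ u ∈ U, cos (φ u) = 0 := by
    intro u hu
    have hd := ((((hφ u hu).cos.pow 2).const_mul D).sub_const C).eq_zero_of_eqOn_isOpen hU hu h
    have hd' : (2 * D * sin (φ u) * k u) * cos (φ u) = 0 := by
      simp at hd
      grind
    have := hk u hu
    have := hs u hu
    have h0 : 2 * D * sin (φ u) * k u ≠ 0 := by positivity
    exact (mul_eq_zero.1 hd').resolve_left h0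
  obtain ⟨x, hx⟩ := hne
  have hd := (hφ x hx).cos.eq_zero_of_eqOn_isOpen hU hx hc
  have := hk x hx
  have := hs x hx
  grind

/-- The algebraic consequence, at points with `cos φ ≠ 0`, of the two relations for the curvature
`k` of the profile curve. -/
theorem profile_factorization {D lam p s c k : ℝ} (hD : D ≠ 0) (hs : s ≠ 0) (hc : c ≠ 0)
    (hsc : s ^ 2 + c ^ 2 = 1)
    (hkL : k * (lam * p - 2 * s) = D * s * c ^ 2)
    (hkk : 2 * k ^ 2 * p = 2 * D ^ 2 * s ^ 2 * c ^ 2 * p + D * c ^ 2 * s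
      + k * p * (lam - 2 * D + 4 * D * s ^ 2)) :
    (lam * p - s) * (D * p * s * (lam * p - s) + (lam - D) * p - 2 * s) = 0 := by
  have h0 : 2 * D * s * c ^ 2 ≠ 0 := by positivity
  refine (mul_eq_zero.1 (?_ : 2 * D * s * c ^ 2 * _ = 0)).resolve_left h0
  have hc2 : c ^ 2 = 1 - s ^ 2 := by linarith
  rw [hc2] at hkL hkk ⊢
  linear_combination (-(lam * p - 2 * s) ^ 2) * hkk
    + (2 * p * (k * (lam * p - 2 * s) + D * s * (1 - s ^ 2))
      - p * (lam - 2 * D + 4 * D * s ^ 2) * (lam * p - 2 * s)) * hkL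

/-- The second factor and its derivative along the profile curve are incompatible unless
`lam + D = 0`. -/
theorem add_eq_zero_of_profile_relation {D lam p s c k : ℝ} (hD : D ≠ 0) (hs : s ≠ 0) (hc : c ≠ 0)
    (hp : p ≠ 0) (hsc : s ^ 2 + c ^ 2 = 1)
    (hkL : k * (lam * p - 2 * s) = D * s * c ^ 2)
    (hM : lam * p - s ≠ 0)
    (hP : D * p * s * (lam * p - s) + (lam - D) * p - 2 * s = 0)
    (hP' : D * s * (lam * p - s) + D * p * k * (lam * p - s) + D * p * s * (lam - k)
      + (lam - D) - 2 * k = 0) : lam + D = 0 := by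
  have hL : lam * p - 2 * s ≠ 0 := by
    intro h
    rw [h, mul_zero] at hkL
    have : D * s * c ^ 2 ≠ 0 := by positivity
    exact this hkL.symm
  have hc2 : c ^ 2 = 1 - s ^ 2 := by linarith
  rw [hc2] at hkL
  obtain ⟨M, hMd⟩ : ∃ M, M = lam * p - s := ⟨_, rfl⟩
  obtain ⟨L, hLd⟩ : ∃ L, L = lam * p - 2 * s := ⟨_, rfl⟩
  obtain ⟨N, hNd⟩ : ∃ N, N = 2 * s - (lam - D) * p := ⟨_, rfl⟩
  rw [← hMd] at hM hP hP'
  rw [← hLd] at hL hkL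
  have hN : D * p * s * M = N := by linarith
  have hN0 : N ≠ 0 := by rw [← hN]; positivity
  have hG : L * (D * s * M + lam * D * p * s + lam - D)
      + D * s * (1 - s ^ 2) * (D * p * M - D * p * s - 2) = 0 := by
    linear_combination L * hP' - (D * p * M - D * p * s - 2) * hkL
  have hW : M * (L - p * D * (1 - s ^ 2)) = -(L * N) := by
    have : M * (L - p * D * (1 - s ^ 2)) = M * L - p * D * M + N * s := by
      rw [← hN]; ring
    rw [this, hNd, hMd, hLd]; ring
  have hpG : L * (2 * s + lam * D * p ^ 2 * s)
      - p * D * (1 - s ^ 2) * (2 * s + lam * D * p ^ 2 * s) + 2 * N * (p * D * (1 - s ^ 2)) = 0 := by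
    have e1 : p * (D * s * M + lam * D * p * s + lam - D) = 2 * s + lam * D * p ^ 2 * s := by
      linear_combination hN + hNd
    have e2 : s * (D * p * M - D * p * s - 2)
        = 2 * N - (2 * s + lam * D * p ^ 2 * s) := by
      rw [hMd] at hN ⊢
      linear_combination 2 * hN
    linear_combination p * hG - L * e1 - p * D * (1 - s ^ 2) * e2
  have hB : -(L * s * (2 + lam * D * p ^ 2)) + 2 * M * p * D - 2 * N * s = 0 := by
    refine (mul_eq_zero.1 (?_ : N * _ = 0)).resolve_left hN0
    linear_combination M * hpG - (2 * s + lam * D * p ^ 2 * s) * hW + 2 * N * s * hN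
  have hfin : p * L ^ 2 * (lam + D) = 0 := by
    have h1 : -(2 * L * s * M) - L * lam * p * N + 2 * M ^ 2 * p * D - 2 * N * s * M = 0 := by
      linear_combination M * hB + L * lam * p * hN
    rw [hNd, hMd, hLd] at h1
    rw [hLd]
    linear_combination h1
  have h0 : p * L ^ 2 ≠ 0 := by positivity
  exact (mul_eq_zero.1 hfin).resolve_left h0

/-- The two relations for the curvature `k` of the profile curve admit no solution on a nonempty
open set on which the mean curvature does not vanish. -/
theorem no_profile_of_mean_curvature_ne_zero {p φ k : ℝ → ℝ} {U : Set ℝ} (hU : IsOpen U)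
    (hne : U.Nonempty) (hpc : Continuous p) (hφc : Continuous φ)
    (hp : ∀ u ∈ U, HasDerivAt p (cos (φ u)) u) (hφ : ∀ u ∈ U, HasDerivAt φ (k u) u)
    (hp0 : ∀ u ∈ U, p u ≠ 0) (hk : ∀ u ∈ U, k u ≠ 0) (hs : ∀ u ∈ U, sin (φ u) ≠ 0)
    {D lam : ℝ} (hD : D ≠ 0) (hH : ∀ u ∈ U, k u * p u + sin (φ u) ≠ 0)
    (hkL : ∀ u ∈ U, k u * (lam * p u - 2 * sin (φ u)) = D * sin (φ u) * cos (φ u) ^ 2)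
    (hkk : ∀ u ∈ U, 2 * k u ^ 2 * p u = 2 * D ^ 2 * sin (φ u) ^ 2 * cos (φ u) ^ 2 * p u
      + D * cos (φ u) ^ 2 * sin (φ u)
      + k u * p u * (lam - 2 * D + 4 * D * sin (φ u) ^ 2)) : False := by
  obtain hc | ⟨V, hVU, hV, hVne, hc⟩ :=
    eqOn_zero_or_exists_isOpen_ne_zero (f := fun u => cos (φ u)) (by fun_prop) hU
  · exact not_cos_sq_const hU hne hφ hk hs one_ne_zero (C := 0)
      (fun u hu => by have h0 : cos (φ u) = 0 := hc u hu; simp [h0])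
  have hfac : ∀ u ∈ V, _ := fun u hu => profile_factorization hD (hs u (hVU hu)) (hc u hu)
    (sin_sq_add_cos_sq _) (hkL u (hVU hu)) (hkk u (hVU hu))
  have hMd : ∀ u ∈ U, HasDerivAt (fun u => lam * p u - sin (φ u))
      (lam * cos (φ u) - cos (φ u) * k u) u :=
    fun u hu => ((hp u hu).const_mul lam).sub (hφ u hu).sin
  obtain hM | ⟨W, hWV, hW, hWne, hM⟩ :=
    eqOn_zero_or_exists_isOpen_ne_zero (f := fun u => lam * p u - sin (φ u)) (by fun_prop) hV
  · refine not_cos_sq_const hV hVne (fun u hu => hφ u (hVU hu)) (fun u hu => hk u (hVU hu))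
      (fun u hu => hs u (hVU hu)) hD (C := -lam) fun u hu => ?_
    have h1 := (hMd u (hVU hu)).eq_zero_of_eqOn_isOpen hV hu hM
    have h2 : k u = lam := by
      have : cos (φ u) * (k u - lam) = 0 := by linarith
      exact sub_eq_zero.1 ((mul_eq_zero.1 this).resolve_left (hc u hu))
    have h3 := hkL u (hVU hu)
    have h4 : lam * p u - sin (φ u) = 0 := hM u hu
    rw [h2] at h3
    refine (mul_eq_zero.1 (?_ : sin (φ u) * _ = 0)).resolve_left (hs u (hVU hu))
    linear_combination lam * h4 - h3
  have hP : ∀ u ∈ W, D * p u * sin (φ u) * (lam * p u - sin (φ u)) + (lam - D) * p u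
      - 2 * sin (φ u) = 0 :=
    fun u hu => (mul_eq_zero.1 (hfac u (hWV hu))).resolve_left (hM u hu)
  have hsum : ∀ u ∈ W, lam + D = 0 := by
    intro u hu
    have huV := hWV hu
    have huU := hVU huV
    have hd := ((((((hp u huU).const_mul D).mul (hφ u huU).sin).mul (hMd u huU)).add
      ((hp u huU).const_mul (lam - D))).sub
      ((hφ u huU).sin.const_mul 2)).eq_zero_of_eqOn_isOpen hW hu hP
    refine add_eq_zero_of_profile_relation hD (hs u huU) (hc u huV) (hp0 u huU)
      (sin_sq_add_cos_sq _) (hkL u huU) (hM u hu) (hP u hu) ?_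
    refine (mul_eq_zero.1 (?_ : cos (φ u) * _ = 0)).resolve_left (hc u huV)
    simp only [Pi.mul_apply] at hd
    linear_combination hd
  obtain ⟨x, hx⟩ := hWne
  have hDl : D = -lam := by linarith [hsum x hx]
  have hps : ∀ u ∈ W, lam * (p u * sin (φ u)) - 2 = 0 := by
    intro u hu
    refine (mul_eq_zero.1 (?_ : (lam * p u - sin (φ u)) * _ = 0)).resolve_left (hM u hu)
    have := hP u hu
    rw [hDl] at this
    linear_combination -this
  have hxV := hWV hx
  have hxU := hVU hxV
  have hd := ((((hp x hxU).mul (hφ x hxU).sin).const_mul lam).sub_const 2).eq_zero_of_eqOn_isOpen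
    hW hx hps
  have hl : lam ≠ 0 := fun h => hD (by rw [hDl, h, neg_zero])
  have h0 : lam * cos (φ x) ≠ 0 := mul_ne_zero hl (hc x hxV)
  refine hH x hxU ((mul_eq_zero.1 (?_ : (lam * cos (φ x)) * _ = 0)).resolve_left h0)
  linear_combination hd

/-- If for some real constants λ, μ the equations Δ^II x = diag(λ,λ,μ)x hold on (a,b),
then H ≡ 0 on (a,b) or p² + q² is constant on (a,b). -/
theorem reduced_main_theorem
    {a b : ℝ} (hab : a < b) (p q φ H : ℝ → ℝ)
    (hp : ContDiff ℝ (⊤ : ℕ∞) p) (hq : ContDiff ℝ (⊤ : ℕ∞) q) (hφ : ContDiff ℝ (⊤ : ℕ∞) φ)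
    (hppos : ∀ u ∈ Ioo a b, 0 < p u)
    (hp' : ∀ u ∈ Ioo a b, deriv p u = Real.cos (φ u))
    (hq' : ∀ u ∈ Ioo a b, deriv q u = Real.sin (φ u))
    (hφ' : ∀ u ∈ Ioo a b, deriv φ u ≠ 0)
    (hsin : ∀ u ∈ Ioo a b, Real.sin (φ u) ≠ 0)
    (hH : ∀ u ∈ Ioo a b, 2 * H u = deriv φ u + Real.sin (φ u) / p u)
    (lam mu : ℝ)
    (h1 : ∀ u ∈ Ioo a b, Real.sin (φ u) + 1 / Real.sin (φ u)
          + deriv (deriv φ) u * Real.cos (φ u) / (2 * deriv φ u ^ 2)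
          - H u * Real.cos (φ u) ^ 2 / (deriv φ u * Real.sin (φ u)) = lam * p u)
    (h2 : ∀ u ∈ Ioo a b, -(3 / 2) * Real.cos (φ u)
          + deriv (deriv φ) u * Real.sin (φ u) / (2 * deriv φ u ^ 2)
          - Real.sin (φ u) * Real.cos (φ u) / (2 * p u * deriv φ u) = mu * q u) :
    (∀ u ∈ Ioo a b, H u = 0) ∨ (∃ c : ℝ, ∀ u ∈ Ioo a b, p u ^ 2 + q u ^ 2 = c) := by
  have hkc : ContDiff ℝ (⊤ : ℕ∞) (deriv φ) := by
    have h := hφ.iterate_deriv 1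
    simpa using h
  have dp : ∀ u ∈ Ioo a b, HasDerivAt p (cos (φ u)) u := fun u hu =>
    hp' u hu ▸ (hp.differentiable (by simp) u).hasDerivAt
  have dq : ∀ u ∈ Ioo a b, HasDerivAt q (sin (φ u)) u := fun u hu =>
    hq' u hu ▸ (hq.differentiable (by simp) u).hasDerivAt
  have dφ : ∀ u, HasDerivAt φ (deriv φ u) u := fun u =>
    (hφ.differentiable (by simp) u).hasDerivAt
  have dk : ∀ u, HasDerivAt (deriv φ) (deriv (deriv φ) u) u := fun u =>
    (hkc.differentiable (by simp) u).hasDerivAt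
  -- the components of the two equations normal and tangent to the profile curve
  have hnt : ∀ u ∈ Ioo a b,
      lam * (p u * sin (φ u)) - mu * (q u * cos (φ u)) - 2 = 0 ∧
      deriv (deriv φ) u * sin (φ u) * p u
        = 2 * deriv φ u ^ 2 * sin (φ u) * p u
            * (lam * (p u * cos (φ u)) + mu * (q u * sin (φ u)))
          - deriv φ u * cos (φ u) * (deriv φ u * p u - sin (φ u)) := by
    intro u hu
    have e1 := h1 u hu
    have e2 := h2 u hu
    have e3 := hH u hu
    have hp0 := (hppos u hu).ne'
    have hk0 := hφ' u hu
    have hs0 := hsin u hu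
    have hsc := sin_sq_add_cos_sq (φ u)
    have eH : H u = (deriv φ u + sin (φ u) / p u) / 2 := by linarith
    rw [eH] at e1
    generalize deriv (deriv φ) u = k2 at *
    generalize deriv φ u = k at *
    generalize sin (φ u) = s at *
    generalize cos (φ u) = c at *
    generalize p u = P at *
    generalize q u = Q at *
    constructor
    · have : lam * (P * s) - mu * (Q * c) = s ^ 2 + c ^ 2 + 1 := by
        calc lam * (P * s) - mu * (Q * c) = (lam * P) * s - (mu * Q) * c := by ring
          _ = s ^ 2 + c ^ 2 + 1 := by
            rw [← e1, ← e2]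
            field_simp
            ring
      linarith
    · have : lam * (P * c) + mu * (Q * s)
          = k2 / (2 * k ^ 2) * (s ^ 2 + c ^ 2) + c / s * (1 - (s ^ 2 + c ^ 2) / 2
            - s / (P * k) * (s ^ 2 + c ^ 2) / 2) := by
        calc lam * (P * c) + mu * (Q * s) = (lam * P) * c + (mu * Q) * s := by ring
          _ = _ := by
            rw [← e1, ← e2]
            field_simp
            ring
      rw [this, hsc]
      field_simp
      ring
  have hA' : ∀ u ∈ Ioo a b, deriv φ u * (lam * (p u * cos (φ u)) + mu * (q u * sin (φ u)))
      - (mu - lam) * (sin (φ u) * cos (φ u)) = 0 := by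
    intro u hu
    have hd := (((((dp u hu).mul (dφ u).sin).const_mul lam).sub
      (((dq u hu).mul (dφ u).cos).const_mul mu)).sub_const 2).eq_zero_of_eqOn_isOpen isOpen_Ioo hu
      (fun v hv => (hnt v hv).1)
    linear_combination hd
  by_cases hD : mu - lam = 0
  · right
    have hml : mu = lam := by linarith
    subst hml
    obtain ⟨x, hx⟩ := nonempty_Ioo.2 hab
    have hmu : mu ≠ 0 := by
      rintro rfl
      have := (hnt x hx).1
      norm_num at this
    have hd : ∀ u ∈ Ioo a b, HasDerivAt (fun u => p u ^ 2 + q u ^ 2) 0 u := by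
      intro u hu
      have h0 : (deriv φ u * mu) * (p u * cos (φ u) + q u * sin (φ u)) = 0 := by
        linear_combination hA' u hu
      have h0' := (mul_eq_zero.1 h0).resolve_left (mul_ne_zero (hφ' u hu) hmu)
      refine (((dp u hu).pow 2).add ((dq u hu).pow 2)).congr_deriv ?_
      norm_num
      linear_combination 2 * h0'
    refine ⟨p x ^ 2 + q x ^ 2, fun u hu => ?_⟩
    exact isOpen_Ioo.is_const_of_deriv_eq_zero isPreconnected_Ioo
      (fun v hv => (hd v hv).differentiableAt.differentiableWithinAt)
      (fun v hv => (hd v hv).deriv) hu hx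
  · left
    by_contra! hex
    obtain ⟨x, hx, hHx⟩ := hex
    have hcont : Continuous fun u => deriv φ u * p u + sin (φ u) := by
      have := hkc.continuous
      have := hp.continuous
      have := hφ.continuous
      fun_prop
    have hxne : deriv φ x * p x + sin (φ x) ≠ 0 := by
      intro h
      apply hHx
      have e := hH x hx
      have hp0 := (hppos x hx).ne'
      field_simp at e
      have : H x * (2 * p x) = 0 := by linarith
      exact (mul_eq_zero.1 this).resolve_right (by positivity)
    refine no_profile_of_mean_curvature_ne_zero (p := p) (φ := φ) (k := deriv φ)
      (U := Ioo a b ∩ {u | deriv φ u * p u + sin (φ u) ≠ 0}) (lam := lam)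
      (isOpen_Ioo.inter (isOpen_ne_fun hcont continuous_const)) ⟨x, hx, hxne⟩ hp.continuous
      hφ.continuous (fun u hu => dp u hu.1) (fun u _ => dφ u) (fun u hu => (hppos u hu.1).ne')
      (fun u hu => hφ' u hu.1) (fun u hu => hsin u hu.1) hD (fun u hu => hu.2) ?_ ?_
    · rintro u ⟨hu, -⟩
      have hsc := sin_sq_add_cos_sq (φ u)
      linear_combination cos (φ u) * hA' u hu + sin (φ u) * deriv φ u * (hnt u hu).1
        - deriv φ u * lam * p u * hsc
    · rintro u ⟨hu, -⟩
      have hd := (((dk u).mul ((((dp u hu).mul (dφ u).cos).const_mul lam).add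
        (((dq u hu).mul (dφ u).sin).const_mul mu))).sub
        (((dφ u).sin.mul (dφ u).cos).const_mul (mu - lam))).eq_zero_of_eqOn_isOpen isOpen_Ioo hu hA'
      simp only [Pi.mul_apply, Pi.add_apply] at hd
      obtain ⟨hn, ht⟩ := hnt u hu
      have hX := hA' u hu
      have hs0 := hsin u hu
      have hsc := sin_sq_add_cos_sq (φ u)
      generalize deriv (deriv φ) u = k2 at *
      generalize deriv φ u = k at *
      generalize sin (φ u) = s at *
      generalize cos (φ u) = c at *
      generalize p u = P at *
      generalize q u = Q at *
      obtain ⟨X, hXd⟩ : ∃ X, X = lam * (P * c) + mu * (Q * s) := ⟨_, rfl⟩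
      rw [← hXd] at hX ht hd
      have hd' : k2 * X + k * (lam * c ^ 2 + mu * s ^ 2 - 2 * k)
          - (mu - lam) * k * (c ^ 2 - s ^ 2) = 0 := by
        linear_combination hd + k ^ 2 * hn
      refine sub_eq_zero.1 ((mul_eq_zero.1 (?_ : s * _ = 0)).resolve_left hs0)
      have hc2 : lam - 2 * (mu - lam) + 4 * (mu - lam) * s ^ 2
          = (3 * lam - 2 * mu) * c ^ 2 + (2 * mu - lam) * s ^ 2 := by
        linear_combination (2 * mu - 3 * lam) * hsc
      rw [hc2]
      linear_combination (-(s * P)) * hd' + X * ht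
        + (2 * s * P * (k * X + (mu - lam) * s * c) - c * (k * P - s)) * hX
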